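/- arXiv:1007.4084 — 2 statements merged into one kernel-verified Lean document; each statement's English description precedes it below -/
import Mathlib

section
/- Let p be an odd prime, let V = (F_p)⁴ with basis x₁, x₂, x₃, x₄, and let Q be the quadratic form on the exterior square Λ²V defined by Q(α₁ x₁∧x₂ + α₂ x₁∧x₃ + α₃ x₁∧x₄ + α₄ x₂∧x₃ + α₅ x₂∧x₄ + α₆ x₃∧x₄) = α₁α₆ − α₂α₅ + α₃α₄, with associated symmetric bilinear form (v,w) = Q(v+w) − Q(v) − Q(w). Let U be a proper subspace of Λ²V, and let GL(V)_U be the setwise stabilizer of U under the exterior square action of GL(V) on Λ²V. Then GL(V)_U acts irreducibly on both V and Λ²V/U if and only if U is non-degenerate, i.e., U ∩ U^⊥ = 0 where U^⊥ = {v ∈ Λ²V : (u,v) = 0 for all u ∈ U}. -/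
open Matrix

section

variable {F : Type*} [CommRing F]

/-- The enumeration `x₁∧x₂, x₁∧x₃, x₁∧x₄, x₂∧x₃, x₂∧x₄, x₃∧x₄` of the basis
of `Λ²V` for `V = F⁴` with basis `x₁, x₂, x₃, x₄`. -/
def pairs : Fin 6 → Fin 4 × Fin 4 := ![(0, 1), (0, 2), (0, 3), (1, 2), (1, 3), (2, 3)]

/-- The matrix of the exterior square action `g ∧ g` of `g` on `Λ²V`
(acting on row vectors), whose entries are the `2 × 2` minors of `g`. -/
def wedgeMatrix (g : Matrix (Fin 4) (Fin 4) F) : Matrix (Fin 6) (Fin 6) F :=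
  Matrix.of fun a b =>
    g (pairs a).1 (pairs b).1 * g (pairs a).2 (pairs b).2 -
      g (pairs a).1 (pairs b).2 * g (pairs a).2 (pairs b).1

/-- The quadratic form
`Q(α₁ x₁∧x₂ + ⋯ + α₆ x₃∧x₄) = α₁α₆ − α₂α₅ + α₃α₄` on `Λ²V`. -/
def Qform (a : Fin 6 → F) : F := a 0 * a 5 - a 1 * a 4 + a 2 * a 3

/-- The symmetric bilinear form associated to `Q`. -/
def Bform (v w : Fin 6 → F) : F := Qform (v + w) - Qform v - Qform w

/-- `g` lies in the setwise stabilizer `GL(V)_U` of `U ≤ Λ²V`. -/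
def StabilizesWedge (g : GL (Fin 4) F) (U : Submodule F (Fin 6 → F)) : Prop :=
  Submodule.map (Matrix.vecMulLinear (wedgeMatrix (g : Matrix (Fin 4) (Fin 4) F))) U = U

end

section SkewMatrices

variable {F : Type*} [CommRing F]

lemma Bform_eq (v w : Fin 6 → F) : Bform v w =
    v 0 * w 5 + w 0 * v 5 - v 1 * w 4 - w 1 * v 4 + v 2 * w 3 + w 2 * v 3 := by
  simp only [Bform, Qform, Pi.add_apply]; ring

lemma Bform_comm (v w : Fin 6 → F) : Bform v w = Bform w v := by
  simp only [Bform_eq]; ring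

lemma Bform_self (v : Fin 6 → F) : Bform v v = 2 * Qform v := by
  simp only [Bform_eq, Qform]; ring

lemma Qform_add (v w : Fin 6 → F) : Qform (v + w) = Qform v + Qform w + Bform v w := by
  simp only [Bform]; ring

lemma Qform_smul (c : F) (v : Fin 6 → F) : Qform (c • v) = c ^ 2 * Qform v := by
  simp only [Qform, Pi.smul_apply, smul_eq_mul]; ring

/-- The symmetric bilinear form `Bform` as a Mathlib bilinear form. -/
def wedgeForm : LinearMap.BilinForm F (Fin 6 → F) :=
  LinearMap.mk₂ F Bform
    (fun _ _ _ => by simp only [Bform_eq, Pi.add_apply]; ring)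
    (fun _ _ _ => by simp only [Bform_eq, Pi.smul_apply, smul_eq_mul]; ring)
    (fun _ _ _ => by simp only [Bform_eq, Pi.add_apply]; ring)
    (fun _ _ _ => by simp only [Bform_eq, Pi.smul_apply, smul_eq_mul]; ring)

lemma wedgeForm_apply (v w : Fin 6 → F) : wedgeForm v w = Bform v w := rfl

/-- The alternating matrix attached to a bivector. -/
def skew : (Fin 6 → F) →ₗ[F] Matrix (Fin 4) (Fin 4) F where
  toFun x := !![0, x 0, x 1, x 2; -x 0, 0, x 3, x 4; -x 1, -x 3, 0, x 5; -x 2, -x 4, -x 5, 0]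
  map_add' x y := by
    ext i j; fin_cases i <;> fin_cases j <;> simp [add_comm]
  map_smul' c x := by
    ext i j; fin_cases i <;> fin_cases j <;> simp

/-- The Pfaffian dual of `skew x`. -/
def skewDual : (Fin 6 → F) →ₗ[F] Matrix (Fin 4) (Fin 4) F where
  toFun x := !![0, -x 5, x 4, -x 3; x 5, 0, -x 2, x 1; -x 4, x 2, 0, -x 0; x 3, -x 1, x 0, 0]
  map_add' x y := by
    ext i j; fin_cases i <;> fin_cases j <;> simp [add_comm]
  map_smul' c x := by
    ext i j; fin_cases i <;> fin_cases j <;> simp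

lemma skew_apply (x : Fin 6 → F) : skew x =
    !![0, x 0, x 1, x 2; -x 0, 0, x 3, x 4; -x 1, -x 3, 0, x 5; -x 2, -x 4, -x 5, 0] := rfl

lemma skewDual_apply (x : Fin 6 → F) : skewDual x =
    !![0, -x 5, x 4, -x 3; x 5, 0, -x 2, x 1; -x 4, x 2, 0, -x 0; x 3, -x 1, x 0, 0] := rfl

lemma skew_injective : Function.Injective (skew : (Fin 6 → F) →ₗ[F] _) := by
  intro x y h
  have h' i j := congrFun (congrFun h i) j
  have h0 := h' 0 1; have h1 := h' 0 2; have h2 := h' 0 3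
  have h3 := h' 1 2; have h4 := h' 1 3; have h5 := h' 2 3
  simp [skew_apply] at h0 h1 h2 h3 h4 h5
  ext i; fin_cases i <;> assumption

lemma skew_transpose (x : Fin 6 → F) : (skew x)ᵀ = -skew x := by
  ext i j; fin_cases i <;> fin_cases j <;> simp [skew_apply]

lemma skewDual_transpose (x : Fin 6 → F) : (skewDual x)ᵀ = -skewDual x := by
  ext i j; fin_cases i <;> fin_cases j <;> simp [skewDual_apply]

lemma skew_of_alternating {M : Matrix (Fin 4) (Fin 4) F} (h0 : ∀ k, M k k = 0)
    (hM : ∀ k l, M l k = -M k l) : skew (fun b => M (pairs b).1 (pairs b).2) = M := by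
  ext k l
  fin_cases k <;> fin_cases l <;> simp [skew_apply, pairs, h0] <;> exact (hM _ _).symm

lemma exists_skewDual_of_alternating {M : Matrix (Fin 4) (Fin 4) F} (h0 : ∀ k, M k k = 0)
    (hM : ∀ k l, M l k = -M k l) : ∃ x, skewDual x = M := by
  refine ⟨![-M 2 3, M 1 3, -M 1 2, -M 0 3, M 0 2, -M 0 1], ?_⟩
  ext k l
  fin_cases k <;> fin_cases l <;> simp [skewDual_apply, h0] <;> exact (hM _ _).symm

lemma skew_vecMul_wedgeMatrix (g : Matrix (Fin 4) (Fin 4) F) (x : Fin 6 → F) :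
    skew (x ᵥ* wedgeMatrix g) = gᵀ * skew x * g := by
  have h0 (k : Fin 4) : (gᵀ * skew x * g) k k = 0 := by
    simp [skew_apply, Matrix.mul_apply, Fin.sum_univ_succ]
    ring
  have hM (k l : Fin 4) : (gᵀ * skew x * g) l k = -(gᵀ * skew x * g) k l := by
    simp [skew_apply, Matrix.mul_apply, Fin.sum_univ_succ]
    ring
  rw [← skew_of_alternating h0 hM]
  congr 1
  ext b
  simp [skew_apply, Matrix.mul_apply, Fin.sum_univ_succ, Matrix.vecMul, dotProduct, wedgeMatrix,
    pairs]
  ring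

set_option maxHeartbeats 1000000 in
lemma Qform_vecMul_wedgeMatrix (g : Matrix (Fin 4) (Fin 4) F) (x : Fin 6 → F) :
    Qform (x ᵥ* wedgeMatrix g) = g.det * Qform x := by
  simp [Qform, Matrix.det_succ_row_zero, Fin.sum_univ_succ, Matrix.vecMul, dotProduct, wedgeMatrix,
      pairs, Fin.succAbove]
  ring

lemma Bform_vecMul_wedgeMatrix (g : Matrix (Fin 4) (Fin 4) F) (x y : Fin 6 → F) :
    Bform (x ᵥ* wedgeMatrix g) (y ᵥ* wedgeMatrix g) = g.det * Bform x y := by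
  rw [Bform, ← Matrix.add_vecMul]
  simp only [Qform_vecMul_wedgeMatrix, Bform]
  ring

lemma skew_mul_skewDual_add (a x : Fin 6 → F) :
    skew a * skewDual x + skew x * skewDual a = Bform a x • (1 : Matrix (Fin 4) (Fin 4) F) := by
  ext i j
  fin_cases i <;> fin_cases j <;>
    simp [skew_apply, skewDual_apply, Bform_eq] <;> ring

lemma skewDual_mul_skew_add (a x : Fin 6 → F) :
    skewDual a * skew x + skewDual x * skew a = Bform a x • (1 : Matrix (Fin 4) (Fin 4) F) := by
  ext i j
  fin_cases i <;> fin_cases j <;>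
    simp [skew_apply, skewDual_apply, Bform_eq] <;> ring

lemma skew_mul_skewDual (a : Fin 6 → F) :
    skew a * skewDual a = Qform a • (1 : Matrix (Fin 4) (Fin 4) F) := by
  ext i j
  fin_cases i <;> fin_cases j <;>
    simp [skew_apply, skewDual_apply, Matrix.mul_apply, Fin.sum_univ_succ, Qform] <;> ring

lemma skewDual_mul_skew (a : Fin 6 → F) :
    skewDual a * skew a = Qform a • (1 : Matrix (Fin 4) (Fin 4) F) := by
  ext i j
  fin_cases i <;> fin_cases j <;>
    simp [skew_apply, skewDual_apply, Matrix.mul_apply, Fin.sum_univ_succ, Qform] <;> ring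

/-- The multiple `-Q(a) r_a` of the reflection `r_a` in `a`. -/
def scaledReflection (a x : Fin 6 → F) : Fin 6 → F := Bform a x • a - Qform a • x

lemma skewDual_mul_skew_mul_skewDual (a x : Fin 6 → F) :
    skewDual a * skew x * skewDual a = skewDual (scaledReflection a x) := by
  rw [eq_sub_of_add_eq (skewDual_mul_skew_add a x), sub_mul, mul_assoc, skew_mul_skewDual]
  simp [scaledReflection]

lemma skew_mul_skewDual_mul_skew (a x : Fin 6 → F) :
    skew a * skewDual x * skew a = skew (scaledReflection a x) := by
  rw [eq_sub_of_add_eq (skew_mul_skewDual_add a x), sub_mul, mul_assoc, skewDual_mul_skew]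
  simp [scaledReflection]

lemma vecMul_wedgeMatrix_skewDual_mul_skew (a b x : Fin 6 → F) :
    x ᵥ* wedgeMatrix (skewDual a * skew b) = scaledReflection b (scaledReflection a x) := by
  apply skew_injective
  rw [skew_vecMul_wedgeMatrix, ← skew_mul_skewDual_mul_skew, ← skewDual_mul_skew_mul_skewDual,
    Matrix.transpose_mul, skew_transpose, skewDual_transpose]
  simp only [neg_mul_neg, mul_assoc]

lemma scaledReflection_involutive (a x : Fin 6 → F) :
    scaledReflection a (scaledReflection a x) = Qform a ^ 2 • x := by
  have h : Bform a (scaledReflection a x) = Qform a * Bform a x := by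
    simp only [scaledReflection, Bform_eq, Qform, Pi.sub_apply, Pi.smul_apply, smul_eq_mul]; ring
  rw [scaledReflection, h, scaledReflection]
  module

/-- The Plücker relation for entries of a degenerate alternating `4 × 4` matrix. -/
lemma skew_plucker {x : Fin 6 → F} (hx : Qform x = 0) (i j k l : Fin 4) :
    skew x i j * skew x k l = skew x i k * skew x j l - skew x i l * skew x j k := by
  rw [Qform] at hx
  fin_cases i <;> fin_cases j <;> fin_cases k <;> fin_cases l <;> simp [skew_apply] <;>
    first | ring1 | linear_combination hx | linear_combination -hx

end SkewMatrices

section Lines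

variable {K V : Type*} [Field K] [AddCommGroup V] [Module K V] [FiniteDimensional K V]

lemma mem_span_singleton_of_not_le {L P : Submodule K V} (hL : Module.finrank K L ≤ 2)
    (hLP : ¬L ≤ P) {x y : V} (hx : x ∈ L ⊓ P) (hx0 : x ≠ 0) (hy : y ∈ L ⊓ P) :
    y ∈ Submodule.span K {x} := by
  have hlt : L ⊓ P < L := inf_lt_left.2 hLP
  have hle : Submodule.span K {x} ≤ L ⊓ P := by
    rwa [Submodule.span_singleton_le_iff_mem]
  have h1 := Submodule.finrank_lt_finrank_of_lt hlt
  have h2 : Module.finrank K (Submodule.span K {x}) = 1 := finrank_span_singleton hx0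
  rwa [Submodule.eq_of_le_of_finrank_le hle (by omega)]

/-- Pairwise meeting lines of a projective space all pass through a common point, or all lie in
a common plane. -/
lemma exists_common_point_or_plane {ι : Type*} (L : ι → Submodule K V)
    (hL : ∀ i, Module.finrank K (L i) ≤ 2) (hmeet : ∀ i j, L i ⊓ L j ≠ ⊥) :
    (∃ a ≠ 0, ∀ i, a ∈ L i) ∨ ∃ P : Submodule K V, Module.finrank K P ≤ 3 ∧ ∀ i, L i ≤ P := by
  by_cases hle : ∀ i j, L i ≤ L j
  · by_cases hι : Nonempty ι
    · obtain ⟨i⟩ := hι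
      obtain ⟨a, ha, ha0⟩ := Submodule.exists_mem_ne_zero_of_ne_bot (hmeet i i)
      exact .inl ⟨a, ha0, fun j => hle i j ha.1⟩
    · exact .inr ⟨⊥, by simp, fun i => (hι ⟨i⟩).elim⟩
  push Not at hle
  obtain ⟨i, j, hij⟩ := hle
  obtain ⟨a, ha, ha0⟩ := Submodule.exists_mem_ne_zero_of_ne_bot (hmeet i j)
  have hP : Module.finrank K ↥(L i ⊔ L j) ≤ 3 := by
    have h1 := Submodule.finrank_sup_add_finrank_inf_eq (L i) (L j)
    have h2 := Submodule.one_le_finrank_iff.2 (hmeet i j)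
    have := hL i
    have := hL j
    omega
  have key (k : ι) (hk : ¬L k ≤ L i ⊔ L j) : a ∈ L k := by
    obtain ⟨x, hx, hx0⟩ := Submodule.exists_mem_ne_zero_of_ne_bot (hmeet k i)
    obtain ⟨y, hy, hy0⟩ := Submodule.exists_mem_ne_zero_of_ne_bot (hmeet k j)
    have hxP : x ∈ L i ⊔ L j := Submodule.mem_sup_left hx.2
    have hyP : y ∈ L i ⊔ L j := Submodule.mem_sup_right hy.2
    have hxy := mem_span_singleton_of_not_le (hL k) hk ⟨hy.1, hyP⟩ hy0 ⟨hx.1, hxP⟩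
    have hxj : x ∈ L j := (Submodule.span_singleton_le_iff_mem _ _).2 hy.2 hxy
    have hax := mem_span_singleton_of_not_le (hL i) hij ⟨hx.2, hxj⟩ hx0 ha
    exact (Submodule.span_singleton_le_iff_mem _ _).2 hx.1 hax
  by_cases hall : ∀ k, a ∈ L k
  · exact .inl ⟨a, ha0, hall⟩
  push Not at hall
  obtain ⟨m, hm⟩ := hall
  refine .inr ⟨L i ⊔ L j, hP, fun k => ?_⟩
  by_contra hk
  have hmP : L m ≤ L i ⊔ L j := by
    by_contra h
    exact hm (key m h)
  obtain ⟨z, hz, hz0⟩ := Submodule.exists_mem_ne_zero_of_ne_bot (hmeet k m)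
  have haz := mem_span_singleton_of_not_le (hL k) hk ⟨hz.1, hmP hz.2⟩ hz0
    ⟨key k hk, Submodule.mem_sup_left ha.1⟩
  exact hm ((Submodule.span_singleton_le_iff_mem _ _).2 hz.2 haz)

lemma map_eq_of_map_le {f : V →ₗ[K] V} (hf : Function.Injective f) {S : Submodule K V}
    (h : S.map f ≤ S) : S.map f = S :=
  Submodule.eq_of_le_of_finrank_eq h (LinearEquiv.finrank_map_eq (LinearEquiv.ofInjectiveEndo f hf) S)

end Lines

section TotallySingular

variable {K : Type*} [Field K]

/-- The row space of `skew w`; for `w = u ∧ v ≠ 0` this is the plane spanned by `u` and `v`. -/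
def supportSpace (w : Fin 6 → K) : Submodule K (Fin 4 → K) :=
  LinearMap.range (Matrix.vecMulLinear (skew w))

lemma row_mem_supportSpace (w : Fin 6 → K) (i : Fin 4) : skew w i ∈ supportSpace w :=
  ⟨Pi.single i 1, by simp [Matrix.row]⟩

lemma supportSpace_le_span {w : Fin 6 → K} (hw : Qform w = 0) {i j : Fin 4}
    (hij : skew w i j ≠ 0) :
    supportSpace w ≤ Submodule.span K {skew w i, skew w j} := by
  rintro _ ⟨u, rfl⟩
  rw [Matrix.vecMulLinear_apply, Matrix.vecMul_eq_sum]
  refine Submodule.sum_mem _ fun k _ => Submodule.smul_mem _ _ ?_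
  have hk : skew w k = (skew w i j)⁻¹ • (skew w i k • skew w j - skew w j k • skew w i) := by
    rw [eq_inv_smul_iff₀ hij]
    ext l
    have := skew_plucker hw i j k l
    simp only [Pi.smul_apply, Pi.sub_apply, smul_eq_mul]
    linear_combination this
  rw [hk]
  exact Submodule.smul_mem _ _ (Submodule.sub_mem _
    (Submodule.smul_mem _ _ (Submodule.subset_span (by simp)))
    (Submodule.smul_mem _ _ (Submodule.subset_span (by simp))))

lemma exists_skew_ne_zero {w : Fin 6 → K} (hw : w ≠ 0) : ∃ i j, skew w i j ≠ 0 := by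
  by_contra! h
  refine hw (skew_injective ?_)
  ext i j
  simp [h]

lemma finrank_supportSpace_le {w : Fin 6 → K} (hw : Qform w = 0) (hw0 : w ≠ 0) :
    Module.finrank K (supportSpace w) ≤ 2 := by
  obtain ⟨i, j, hij⟩ := exists_skew_ne_zero hw0
  classical
  have h := finrank_span_finset_le_card (R := K) {skew w i, skew w j}
  rw [Finset.coe_pair] at h
  exact (Submodule.finrank_mono (supportSpace_le_span hw hij)).trans (h.trans Finset.card_le_two)

lemma skew_diag (w : Fin 6 → K) (i : Fin 4) : skew w i i = 0 := by
  fin_cases i <;> simp [skew_apply]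

lemma skew_swap (w : Fin 6 → K) (i j : Fin 4) : skew w j i = -skew w i j :=
  congrFun (congrFun (skew_transpose w) i) j

lemma smul_rows_eq_zero {w : Fin 6 → K} {i j : Fin 4} (hij : skew w i j ≠ 0) {c d : K}
    (h : c • skew w i + d • skew w j = 0) : c = 0 ∧ d = 0 := by
  have hi := congrFun h i
  have hj := congrFun h j
  simp only [Pi.add_apply, Pi.smul_apply, smul_eq_mul, Pi.zero_apply, skew_diag, mul_zero,
    zero_add, add_zero, skew_swap w i j, mul_neg, neg_eq_zero, mul_eq_zero, hij, or_false] at hi hj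
  exact ⟨hj, hi⟩

lemma supportSpace_inf_ne_bot {w w' : Fin 6 → K} (hw : Qform w = 0) (hw0 : w ≠ 0)
    (hw' : Qform w' = 0) (hw0' : w' ≠ 0) (hB : Bform w w' = 0) :
    supportSpace w ⊓ supportSpace w' ≠ ⊥ := by
  obtain ⟨i, j, hij⟩ := exists_skew_ne_zero hw0
  obtain ⟨k, l, hkl⟩ := exists_skew_ne_zero hw0'
  let M : Matrix (Fin 4) (Fin 4) K := ![skew w i, skew w j, skew w' k, skew w' l]
  have hM : M.det = 0 := by
    have h1 : ![1, 0, 0, 0, 0, 1] ᵥ* wedgeMatrix M = skew w i j • w + skew w' k l • w' := by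
      have hrow (v : Fin 6 → K) (hv : Qform v = 0) (i j : Fin 4) (b : Fin 6) :
          skew v i (pairs b).1 * skew v j (pairs b).2 -
            skew v i (pairs b).2 * skew v j (pairs b).1 = skew v i j * v b := by
        rw [← skew_plucker hv]
        congr 1
        fin_cases b <;> simp [skew_apply, pairs]
      ext b
      rw [Pi.add_apply, Pi.smul_apply, Pi.smul_apply, smul_eq_mul, smul_eq_mul,
        ← hrow w hw, ← hrow w' hw']
      simp [Matrix.vecMul, dotProduct, Fin.sum_univ_succ, wedgeMatrix, M, pairs]
    have h2 := Qform_vecMul_wedgeMatrix M ![1, 0, 0, 0, 0, 1]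
    have h3 : Qform ![(1 : K), 0, 0, 0, 0, 1] = 1 := by simp [Qform]
    rw [h1, h3, mul_one] at h2
    rw [← h2, Qform_add, Qform_smul, Qform_smul, hw, hw']
    rw [Bform_eq] at hB ⊢
    simp only [Pi.smul_apply, smul_eq_mul]
    linear_combination skew w i j * skew w' k l * hB
  obtain ⟨v, hv0, hv⟩ := Matrix.exists_vecMul_eq_zero_iff.2 hM
  have hsum : v 0 • skew w i + v 1 • skew w j = -(v 2 • skew w' k + v 3 • skew w' l) := by
    rw [Matrix.vecMul_eq_sum] at hv
    simp only [Fin.sum_univ_four] at hv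
    rw [← sub_eq_zero, ← hv]
    simp [M]
    abel
  intro hbot
  have hmem : v 0 • skew w i + v 1 • skew w j ∈ supportSpace w ⊓ supportSpace w' := by
    refine ⟨add_mem (Submodule.smul_mem _ _ (row_mem_supportSpace _ _))
      (Submodule.smul_mem _ _ (row_mem_supportSpace _ _)), ?_⟩
    rw [hsum]
    exact neg_mem (add_mem (Submodule.smul_mem _ _ (row_mem_supportSpace _ _))
      (Submodule.smul_mem _ _ (row_mem_supportSpace _ _)))
  rw [hbot, Submodule.mem_bot] at hmem
  rw [hmem, eq_comm, neg_eq_zero] at hsum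
  obtain ⟨h0, h1⟩ := smul_rows_eq_zero hij hmem
  obtain ⟨h2, h3⟩ := smul_rows_eq_zero hkl hsum
  apply hv0
  ext m
  fin_cases m <;> assumption

lemma vecMul_injective (g : GL (Fin 4) K) :
    Function.Injective (Matrix.vecMulLinear (g : Matrix (Fin 4) (Fin 4) K)) :=
  Matrix.vecMul_injective_of_isUnit g.isUnit

lemma wedge_injective (g : GL (Fin 4) K) :
    Function.Injective (Matrix.vecMulLinear (wedgeMatrix (g : Matrix (Fin 4) (Fin 4) K))) := by
  rw [← LinearMap.ker_eq_bot, LinearMap.ker_eq_bot']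
  intro x hx
  have h := skew_vecMul_wedgeMatrix (g : Matrix (Fin 4) (Fin 4) K) x
  rw [Matrix.vecMulLinear_apply] at hx
  rw [hx, map_zero, eq_comm, g.isUnit.mul_left_eq_zero,
    (Matrix.isUnit_transpose _ |>.2 g.isUnit).mul_right_eq_zero] at h
  exact skew_injective (h.trans (map_zero _).symm)

lemma map_supportSpace (g : GL (Fin 4) K) (w : Fin 6 → K) :
    (supportSpace w).map (Matrix.vecMulLinear (g : Matrix (Fin 4) (Fin 4) K)) =
      supportSpace (w ᵥ* wedgeMatrix (g : Matrix (Fin 4) (Fin 4) K)) := by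
  have hg : (Matrix.vecMulLinear (g : Matrix (Fin 4) (Fin 4) K)ᵀ).range = ⊤ :=
    LinearMap.range_eq_top.2 <| LinearMap.surjective_of_injective <|
      Matrix.vecMul_injective_of_isUnit (Matrix.isUnit_transpose _ |>.2 g.isUnit)
  have h : Matrix.vecMulLinear (skew (w ᵥ* wedgeMatrix (g : Matrix (Fin 4) (Fin 4) K))) =
      Matrix.vecMulLinear (g : Matrix (Fin 4) (Fin 4) K) ∘ₗ Matrix.vecMulLinear (skew w) ∘ₗ
        Matrix.vecMulLinear (g : Matrix (Fin 4) (Fin 4) K)ᵀ := by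
    refine LinearMap.ext fun u => ?_
    simp only [LinearMap.comp_apply, Matrix.vecMulLinear_apply, skew_vecMul_wedgeMatrix,
      Matrix.vecMul_vecMul, mul_assoc]
  rw [supportSpace, supportSpace, h, LinearMap.range_comp, LinearMap.range_comp, hg,
    Submodule.map_top]

/-- The stabilizer of a non-zero totally singular subspace is reducible on `V`. -/
lemma exists_invariant_of_totally_singular {W : Submodule K (Fin 6 → K)} (hW : W ≠ ⊥)
    (hsing : ∀ w ∈ W, Qform w = 0) :
    ∃ S : Submodule K (Fin 4 → K), S ≠ ⊥ ∧ S ≠ ⊤ ∧ ∀ g : GL (Fin 4) K, StabilizesWedge g W →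
      S.map (Matrix.vecMulLinear (g : Matrix (Fin 4) (Fin 4) K)) = S := by
  let ι := {w : W // (w : Fin 6 → K) ≠ 0}
  let L : ι → Submodule K (Fin 4 → K) := fun w => supportSpace (w : Fin 6 → K)
  have hL (w : ι) : Module.finrank K (L w) ≤ 2 := finrank_supportSpace_le (hsing _ w.1.2) w.2
  have hmeet (w w' : ι) : L w ⊓ L w' ≠ ⊥ :=
    supportSpace_inf_ne_bot (hsing _ w.1.2) w.2 (hsing _ w'.1.2) w'.2
      (by rw [Bform, hsing _ (add_mem w.1.2 w'.1.2), hsing _ w.1.2, hsing _ w'.1.2]; simp)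
  obtain ⟨w, hwW, hw0⟩ := Submodule.exists_mem_ne_zero_of_ne_bot hW
  let w₀ : ι := ⟨⟨w, hwW⟩, hw0⟩
  have hperm (g : GL (Fin 4) K) (hg : StabilizesWedge g W) (w : ι) :
      ∃ w' : ι, (L w).map (Matrix.vecMulLinear (g : Matrix (Fin 4) (Fin 4) K)) = L w' := by
    have hmem : (w : Fin 6 → K) ᵥ* wedgeMatrix (g : Matrix (Fin 4) (Fin 4) K) ∈ W :=
      hg.le ⟨_, w.1.2, rfl⟩
    refine ⟨⟨⟨_, hmem⟩, fun h => w.2 (wedge_injective g ?_)⟩, map_supportSpace g _⟩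
    rw [map_zero]
    exact h
  have hperm' (g : GL (Fin 4) K) (hg : StabilizesWedge g W) (w' : ι) :
      ∃ w : ι, (L w).map (Matrix.vecMulLinear (g : Matrix (Fin 4) (Fin 4) K)) = L w' := by
    obtain ⟨w, hw, hww'⟩ := hg.ge w'.1.2
    refine ⟨⟨⟨w, hw⟩, fun h => w'.2 ?_⟩, (map_supportSpace g _).trans (congrArg _ hww')⟩
    rw [← hww']
    simp only at h
    rw [h, map_zero]
  rcases exists_common_point_or_plane L hL hmeet with ⟨a, ha0, ha⟩ | ⟨P, hP, hLP⟩
  · refine ⟨⨅ w, L w, ?_, ?_, fun g hg => map_eq_of_map_le (vecMul_injective g) ?_⟩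
    · exact Submodule.ne_bot_iff _ |>.2 ⟨a, by simpa using ha, ha0⟩
    · intro h
      have h1 := hL w₀
      rw [iInf_eq_top.1 h w₀] at h1
      simp at h1
    · refine le_iInf fun w' => ?_
      obtain ⟨w, hw⟩ := hperm' g hg w'
      rw [← hw]
      exact Submodule.map_mono (iInf_le _ _)
  · refine ⟨⨆ w, L w, ?_, ?_, fun g hg => map_eq_of_map_le (vecMul_injective g) ?_⟩
    · intro h
      have h1 := hmeet w₀ w₀
      rw [iSup_eq_bot.1 h w₀] at h1
      simp at h1
    · intro h
      rw [show P = ⊤ from top_le_iff.1 (h ▸ iSup_le hLP)] at hP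
      simp at hP
    · rw [Submodule.map_iSup]
      refine iSup_le fun w => ?_
      obtain ⟨w', hw'⟩ := hperm g hg w
      rw [hw']
      exact le_iSup L w'

end TotallySingular

section Nondegenerate

variable {K : Type*} [Field K]

lemma wedgeForm_isRefl : (wedgeForm : LinearMap.BilinForm K (Fin 6 → K)).IsRefl :=
  fun v w h => (Bform_comm w v).trans h

lemma eq_zero_of_Bform_eq_zero {v : Fin 6 → K} (h : ∀ w, Bform w v = 0) : v = 0 := by
  have h' (i : Fin 6) := h (Pi.single i 1)
  ext i
  fin_cases i
  · simpa [Bform_eq] using h' 5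
  · simpa [Bform_eq] using h' 4
  · simpa [Bform_eq] using h' 3
  · simpa [Bform_eq] using h' 2
  · simpa [Bform_eq] using h' 1
  · simpa [Bform_eq] using h' 0

lemma wedgeForm_nondegenerate :
    (wedgeForm : LinearMap.BilinForm K (Fin 6 → K)).Nondegenerate :=
  LinearMap.BilinForm.Nondegenerate.ofSeparatingRight fun _ h => eq_zero_of_Bform_eq_zero h

lemma mem_orthogonal {U : Submodule K (Fin 6 → K)} {v : Fin 6 → K} :
    v ∈ wedgeForm.orthogonal U ↔ ∀ u ∈ U, Bform u v = 0 := Iff.rfl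

lemma orthogonal_orthogonal (U : Submodule K (Fin 6 → K)) :
    wedgeForm.orthogonal (wedgeForm.orthogonal U) = U :=
  LinearMap.BilinForm.orthogonal_orthogonal wedgeForm_nondegenerate wedgeForm_isRefl U

/-- The subspace `U` is non-degenerate with respect to `Q`. -/
def IsNondegenerate (U : Submodule K (Fin 6 → K)) : Prop :=
  ∀ v ∈ U, (∀ u ∈ U, Bform u v = 0) → v = 0

lemma isNondegenerate_iff {U : Submodule K (Fin 6 → K)} :
    IsNondegenerate U ↔ U ⊓ wedgeForm.orthogonal U = ⊥ :=
  ⟨fun h => (Submodule.eq_bot_iff _).2 fun v hv => h v hv.1 hv.2,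
    fun h v hv hv' => (Submodule.eq_bot_iff _).1 h v ⟨hv, hv'⟩⟩

lemma IsNondegenerate.sup_orthogonal {U : Submodule K (Fin 6 → K)} (hU : IsNondegenerate U) :
    U ⊔ wedgeForm.orthogonal U = ⊤ :=
  ((LinearMap.BilinForm.isCompl_orthogonal_iff_disjoint wedgeForm_isRefl).2
    (disjoint_iff.2 (isNondegenerate_iff.1 hU))).sup_eq_top

lemma IsNondegenerate.orthogonal {U : Submodule K (Fin 6 → K)} (hU : IsNondegenerate U) :
    IsNondegenerate (wedgeForm.orthogonal U) := by
  rw [isNondegenerate_iff, orthogonal_orthogonal, inf_comm]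
  exact isNondegenerate_iff.1 hU

/-- A non-degenerate subspace is spanned by its non-singular vectors. -/
lemma IsNondegenerate.le_of_forall_nonsingular (h2 : (2 : K) ≠ 0)
    {U T : Submodule K (Fin 6 → K)} (hU : IsNondegenerate U)
    (hT : ∀ a ∈ U, Qform a ≠ 0 → a ∈ T) : U ≤ T := by
  intro u hu
  by_cases hu0 : u = 0
  · exact hu0 ▸ T.zero_mem
  by_cases hQ : Qform u = 0
  swap
  · exact hT u hu hQ
  obtain ⟨w, hw, hwu⟩ : ∃ w ∈ U, Bform w u ≠ 0 := by
    by_contra! h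
    exact hu0 (hU u hu h)
  let c := Bform w u
  let w' := w + ((1 - Qform w) / c) • u
  let w'' := w' + c⁻¹ • u
  have hcalc (t : K) : Qform (w + t • u) = Qform w + t * c := by
    rw [Qform_add, Qform_smul, hQ]
    simp only [c, Bform_eq, Pi.smul_apply, smul_eq_mul]
    ring
  have hc : c ≠ 0 := hwu
  have h1 : Qform w' = 1 := by
    rw [hcalc]; field_simp; ring
  have h3 : Qform w'' = 2 := by
    have : w'' = w + ((1 - Qform w) / c + c⁻¹) • u := by simp only [w'', w']; module
    rw [this, hcalc]; field_simp; ring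
  have hw' : w' ∈ U := add_mem hw (Submodule.smul_mem _ _ hu)
  have hw'' : w'' ∈ U := add_mem hw' (Submodule.smul_mem _ _ hu)
  have hsub := sub_mem (hT w'' hw'' (h3 ▸ h2)) (hT w' hw' (h1 ▸ one_ne_zero))
  rw [show w'' - w' = c⁻¹ • u by simp [w'']] at hsub
  exact (Submodule.smul_mem_iff _ (inv_ne_zero hc)).1 hsub

lemma IsNondegenerate.exists_nonsingular (h2 : (2 : K) ≠ 0)
    {U : Submodule K (Fin 6 → K)} (hU : IsNondegenerate U) (hbot : U ≠ ⊥) :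
    ∃ a ∈ U, Qform a ≠ 0 := by
  by_contra! h
  exact hbot (le_bot_iff.1 (hU.le_of_forall_nonsingular h2 fun a ha hQ => (hQ (h a ha)).elim))

lemma stabilizesWedge_orthogonal {U : Submodule K (Fin 6 → K)} {g : GL (Fin 4) K}
    (hg : StabilizesWedge g U) : StabilizesWedge g (wedgeForm.orthogonal U) := by
  refine map_eq_of_map_le (wedge_injective g) ?_
  rintro _ ⟨x, hx, rfl⟩
  rw [mem_orthogonal]
  intro u hu
  obtain ⟨u', hu', rfl⟩ := hg.ge hu
  rw [Matrix.vecMulLinear_apply, Matrix.vecMulLinear_apply, Bform_vecMul_wedgeMatrix,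
    mem_orthogonal.1 hx u' hu', mul_zero]

lemma StabilizesWedge.inf {U T : Submodule K (Fin 6 → K)} {g : GL (Fin 4) K}
    (hU : StabilizesWedge g U) (hT : StabilizesWedge g T) : StabilizesWedge g (U ⊓ T) :=
  map_eq_of_map_le (wedge_injective g) <|
    (Submodule.map_inf_le _).trans (inf_le_inf hU.le hT.le)

lemma StabilizesWedge.sup {U T : Submodule K (Fin 6 → K)} {g : GL (Fin 4) K}
    (hU : StabilizesWedge g U) (hT : StabilizesWedge g T) : StabilizesWedge g (U ⊔ T) := by
  rw [StabilizesWedge, Submodule.map_sup, hU, hT]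

/-- The stabilizer of `U` is irreducible on `V`. -/
def IrreducibleOnV (U : Submodule K (Fin 6 → K)) : Prop :=
  ∀ S : Submodule K (Fin 4 → K),
    (∀ g : GL (Fin 4) K, StabilizesWedge g U →
      S.map (Matrix.vecMulLinear (g : Matrix (Fin 4) (Fin 4) K)) = S) → S = ⊥ ∨ S = ⊤

/-- The stabilizer of `U` is irreducible on `Λ²V / U`. -/
def IrreducibleOnQuotient (U : Submodule K (Fin 6 → K)) : Prop :=
  ∀ T : Submodule K (Fin 6 → K), U ≤ T →
    (∀ g : GL (Fin 4) K, StabilizesWedge g U → StabilizesWedge g T) → T = U ∨ T = ⊤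

lemma isNondegenerate_of_irreducible (h2 : (2 : K) ≠ 0) {U : Submodule K (Fin 6 → K)}
    (hU : U ≠ ⊤) (hV : IrreducibleOnV U) (hQ : IrreducibleOnQuotient U) : IsNondegenerate U := by
  by_contra hdeg
  rw [isNondegenerate_iff] at hdeg
  have hperp : wedgeForm.orthogonal U ≤ U := by
    rcases hQ (U ⊔ wedgeForm.orthogonal U) le_sup_left
      fun g hg => hg.sup (stabilizesWedge_orthogonal hg) with h | h
    · exact sup_eq_left.1 h
    · refine (hdeg ((Submodule.eq_bot_iff _).2 fun v hv => eq_zero_of_Bform_eq_zero fun w => ?_)).elim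
      obtain ⟨x, hx, y, hy, rfl⟩ := Submodule.mem_sup.1 (h ▸ Submodule.mem_top : w ∈ _)
      rw [← wedgeForm_apply, map_add, LinearMap.add_apply, wedgeForm_apply, wedgeForm_apply,
        mem_orthogonal.1 hv.2 x hx, Bform_comm, mem_orthogonal.1 hy v hv.1, add_zero]
  have hbot : wedgeForm.orthogonal U ≠ ⊥ := fun h => hU <| by
    rw [← orthogonal_orthogonal U, h, LinearMap.BilinForm.orthogonal_bot]
  obtain ⟨S, hS0, hS1, hS⟩ := exists_invariant_of_totally_singular hbot fun w hw => by
    have := mem_orthogonal.1 hw w (hperp hw)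
    rw [Bform_self] at this
    exact (mul_eq_zero.1 this).resolve_left h2
  exact (hV S fun g hg => hS g (stabilizesWedge_orthogonal hg)).elim hS0 hS1

lemma scaledReflection_mem {U : Submodule K (Fin 6 → K)} {a x : Fin 6 → K}
    (ha : a ∈ U ∨ a ∈ wedgeForm.orthogonal U) (hx : x ∈ U) : scaledReflection a x ∈ U := by
  refine sub_mem ?_ (Submodule.smul_mem _ _ hx)
  rcases ha with ha | ha
  · exact Submodule.smul_mem _ _ ha
  · rw [Bform_comm, mem_orthogonal.1 ha x hx, zero_smul]
    exact U.zero_mem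

/-- For non-singular `a` and `b` in `U ∪ U^⊥`, the matrix `skewDual a * skew b`, which induces
a multiple of the product of reflections in `a` and `b`, lies in the stabilizer of `U`. -/
lemma exists_stabilizer_eq {U : Submodule K (Fin 6 → K)} {a b : Fin 6 → K}
    (ha : a ∈ U ∨ a ∈ wedgeForm.orthogonal U) (hb : b ∈ U ∨ b ∈ wedgeForm.orthogonal U)
    (hQa : Qform a ≠ 0) (hQb : Qform b ≠ 0) :
    ∃ g : GL (Fin 4) K, (g : Matrix (Fin 4) (Fin 4) K) = skewDual a * skew b ∧
      StabilizesWedge g U := by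
  have hua : IsUnit (skewDual a) :=
    IsUnit.of_mul_eq_one ((Qform a)⁻¹ • skew a) <| by
      rw [Matrix.mul_smul, skewDual_mul_skew, inv_smul_smul₀ hQa]
  have hub : IsUnit (skew b) :=
    IsUnit.of_mul_eq_one ((Qform b)⁻¹ • skewDual b) <| by
      rw [Matrix.mul_smul, skew_mul_skewDual, inv_smul_smul₀ hQb]
  obtain ⟨g, hg⟩ := hua.mul hub
  refine ⟨g, hg, map_eq_of_map_le (wedge_injective g) ?_⟩
  rintro _ ⟨x, hx, rfl⟩
  rw [Matrix.vecMulLinear_apply, hg, vecMul_wedgeMatrix_skewDual_mul_skew]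
  exact scaledReflection_mem hb (scaledReflection_mem ha hx)

lemma IsNondegenerate.forall_mem_of_nonsingular (h2 : (2 : K) ≠ 0)
    {U N : Submodule K (Fin 6 → K)} (hU : IsNondegenerate U)
    (hN : ∀ a, a ∈ U ∨ a ∈ wedgeForm.orthogonal U → Qform a ≠ 0 → a ∈ N) (a : Fin 6 → K) :
    a ∈ N := by
  have h : U ⊔ wedgeForm.orthogonal U ≤ N := sup_le
    (hU.le_of_forall_nonsingular h2 fun a ha => hN a (.inl ha))
    (hU.orthogonal.le_of_forall_nonsingular h2 fun a ha => hN a (.inr ha))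
  rw [hU.sup_orthogonal] at h
  exact h Submodule.mem_top

lemma IsNondegenerate.irreducibleOnV (h2 : (2 : K) ≠ 0) {U : Submodule K (Fin 6 → K)}
    (hU : IsNondegenerate U) : IrreducibleOnV U := by
  intro S hS
  have hmem (a b : Fin 6 → K) (v : Fin 4 → K) (hv : v ∈ S) : v ᵥ* (skewDual a * skew b) ∈ S := by
    refine hU.forall_mem_of_nonsingular h2
      (N := S.comap (Matrix.vecMulBilin K K v ∘ₗ LinearMap.mulLeft K (skewDual a) ∘ₗ skew))
      (fun b hb hQb => ?_) b
    refine hU.forall_mem_of_nonsingular h2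
      (N := S.comap (Matrix.vecMulBilin K K v ∘ₗ LinearMap.mulRight K (skew b) ∘ₗ skewDual))
      (fun a ha hQa => ?_) a
    obtain ⟨g, hg, hgU⟩ := exists_stabilizer_eq ha hb hQa hQb
    change v ᵥ* (skewDual a * skew b) ∈ S
    rw [← hg]
    exact (hS g hgU).le ⟨v, hv, rfl⟩
  have hsingle (i j : Fin 4) (hij : i ≠ j) (v : Fin 4 → K) (hv : v ∈ S) :
      Pi.single j (v i) ∈ S := by
    obtain ⟨l, hil, hjl⟩ : ∃ l : Fin 4, i ≠ l ∧ j ≠ l := by decide +revert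
    let E (k m : Fin 4) : Matrix (Fin 4) (Fin 4) K := Matrix.single k m 1 - Matrix.single m k 1
    have hdiag (k m r : Fin 4) : E k m r r = 0 := by simp [E, Matrix.single_apply, and_comm]
    have hswap (k m r s : Fin 4) : E k m s r = -E k m r s := by
      simp [E, Matrix.single_apply, and_comm]
    obtain ⟨a, ha⟩ := exists_skewDual_of_alternating (hdiag i l) (hswap i l)
    have hb := skew_of_alternating (hdiag l j) (hswap l j)
    have h := hmem a (fun b => E l j (pairs b).1 (pairs b).2) v hv
    rw [ha, hb] at h
    convert h using 1
    ext r
    simp [E, sub_mul, mul_sub, hij, hil, hjl.symm, Matrix.vecMul, dotProduct,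
      Matrix.single_apply, Pi.single_apply, eq_comm]
    by_cases hjr : j = r <;> simp [hjr]
  by_cases hbot : S = ⊥
  · exact .inl hbot
  obtain ⟨v, hv, hv0⟩ := Submodule.exists_mem_ne_zero_of_ne_bot hbot
  obtain ⟨i, hi⟩ := Function.ne_iff.1 hv0
  have hne (j : Fin 4) (hij : i ≠ j) (c : K) : Pi.single j c ∈ S := by
    have h := S.smul_mem (c / v i) (hsingle i j hij v hv)
    rwa [← Pi.single_smul, smul_eq_mul, div_mul_cancel₀ _ hi] at h
  have hall (j : Fin 4) (c : K) : Pi.single j c ∈ S := by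
    by_cases hij : i = j
    · obtain ⟨k, hik⟩ := exists_ne i
      simpa using hsingle k j (hij ▸ hik) _ (hne k hik.symm c)
    · exact hne j hij c
  refine .inr (Submodule.eq_top_iff'.2 fun w => ?_)
  rw [← Finset.univ_sum_single w]
  exact S.sum_mem fun j _ => hall j (w j)

end Nondegenerate

section Quotient

variable {K : Type*} [Field K]

/-- Given a hyperbolic pair `e`, `f` of singular vectors, some element of `GL(V)` negates `e` and
fixes `f`. -/
lemma exists_neg_fix {e f : Fin 6 → K} (he : Qform e = 0) (hf : Qform f = 0)
    (hef : Bform e f ≠ 0) : ∃ g : GL (Fin 4) K,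
      e ᵥ* wedgeMatrix (g : Matrix (Fin 4) (Fin 4) K) = -e ∧
      f ᵥ* wedgeMatrix (g : Matrix (Fin 4) (Fin 4) K) = f := by
  have hne : skew e * skewDual f ≠ 0 := by
    intro h
    have h1 := skew_mul_skewDual_add e f
    rw [h, zero_add] at h1
    have h3 : Bform e f • skew e = 0 := by
      have := congrArg (· * skew e) h1
      simpa [mul_assoc, skewDual_mul_skew, he] using this.symm
    have h4 : e = 0 := skew_injective <| by
      rw [map_zero]
      exact (smul_eq_zero.1 h3).resolve_left hef
    exact hef (by simp [h4, Bform_eq])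
  obtain ⟨i, j, ht⟩ : ∃ i j, (skew e * skewDual f) i j ≠ 0 := by
    by_contra! h
    exact hne (by ext i j; simp [h])
  set t := (skew e * skewDual f) i j with ht_def
  let v : Fin 4 → K := skew e i
  let φ : Fin 4 → K := fun k => skewDual f k j
  have hvφ : v ⬝ᵥ φ = t := rfl
  let P := Matrix.vecMulVec φ v
  have hPP : P * P = t • P := by
    rw [Matrix.vecMulVec_mul_vecMulVec, hvφ, Matrix.vecMulVec_smul]
  have hg : (1 - (2 / t) • P) * (1 - (2 / t) • P) = 1 := by
    rw [sub_mul, mul_sub, mul_sub, one_mul, mul_one, one_mul, Matrix.smul_mul, Matrix.mul_smul, hPP,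
      smul_smul, smul_smul, show 2 / t * (2 / t) * t = 2 / t + 2 / t by field_simp; ring]
    module
  have hgE (X : Matrix (Fin 4) (Fin 4) K) : (1 - (2 / t) • P)ᵀ * X * (1 - (2 / t) • P) =
      X - (2 / t) • (Pᵀ * X + X * P) + (2 / t) ^ 2 • (Pᵀ * X * P) := by
    simp only [Matrix.transpose_sub, Matrix.transpose_one, Matrix.transpose_smul, sub_mul, mul_sub,
      one_mul, mul_one, Matrix.smul_mul, Matrix.mul_smul]
    module
  have hPE : Pᵀ * skew e + skew e * P = t • skew e := by
    ext k l
    simp only [Matrix.add_apply, Matrix.mul_apply, Matrix.smul_apply, Matrix.transpose_apply,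
      smul_eq_mul, ht_def, P, Matrix.vecMulVec_apply, Finset.sum_mul, ← Finset.sum_add_distrib]
    refine Finset.sum_congr rfl fun m _ => ?_
    have h := skew_plucker he i m k l
    rw [skew_swap e k m] at h
    linear_combination -φ m * h
  have hPEP : Pᵀ * skew e * P = 0 := by
    have := congrArg (· * P) hPE
    simp only [add_mul, mul_assoc, hPP, Matrix.smul_mul, Matrix.mul_smul] at this
    rw [mul_assoc]
    exact add_eq_right.1 this
  have hFP : skew f * P = 0 := by
    have hφ : skew f *ᵥ φ = 0 := by
      ext k
      have := congrFun (congrFun (skew_mul_skewDual f) k) j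
      rw [hf, zero_smul] at this
      exact this
    rw [Matrix.mul_vecMulVec, hφ, Matrix.zero_vecMulVec]
  have hPF : Pᵀ * skew f = 0 := by
    have := congrArg Matrix.transpose hFP
    rwa [Matrix.transpose_mul, skew_transpose, mul_neg, Matrix.transpose_zero,
      neg_eq_zero] at this
  refine ⟨⟨_, _, hg, hg⟩, skew_injective ?_, skew_injective ?_⟩
  · rw [skew_vecMul_wedgeMatrix, hgE, hPE, hPEP, smul_smul, div_mul_cancel₀ _ ht, map_neg]
    module
  · rw [skew_vecMul_wedgeMatrix, hgE, hPF, hFP]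
    simp

lemma Bform_add_left (x y z : Fin 6 → K) : Bform (x + y) z = Bform x z + Bform y z := by
  rw [← wedgeForm_apply, map_add]; rfl

lemma Bform_smul_left (c : K) (x y : Fin 6 → K) : Bform (c • x) y = c * Bform x y := by
  rw [← wedgeForm_apply, map_smul]; rfl

lemma IsNondegenerate.irreducibleOnQuotient (h2 : (2 : K) ≠ 0) {U : Submodule K (Fin 6 → K)}
    (hU : IsNondegenerate U) : IrreducibleOnQuotient U := by
  intro T hUT hT
  by_contra! hne
  obtain ⟨hTU, hTtop⟩ := hne
  have hrefl {a b x : Fin 6 → K} (ha : a ∈ U ∨ a ∈ wedgeForm.orthogonal U)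
      (hb : b ∈ U ∨ b ∈ wedgeForm.orthogonal U) (hQa : Qform a ≠ 0) (hQb : Qform b ≠ 0)
      (hx : x ∈ T) : scaledReflection b (scaledReflection a x) ∈ T := by
    obtain ⟨g, hg, hgU⟩ := exists_stabilizer_eq ha hb hQa hQb
    rw [← vecMul_wedgeMatrix_skewDual_mul_skew, ← hg]
    exact (hT g hgU).le ⟨x, hx, rfl⟩
  obtain ⟨b₀, hb₀T, hb₀, hQb₀⟩ :
      ∃ b ∈ T, (b ∈ U ∨ b ∈ wedgeForm.orthogonal U) ∧ Qform b ≠ 0 := by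
    by_cases hbot : U = ⊥
    · have hTnd : IsNondegenerate T := by
        rw [isNondegenerate_iff]
        by_contra hW
        obtain ⟨S, hS0, hS1, hS⟩ := exists_invariant_of_totally_singular hW fun w hw => by
          have := mem_orthogonal.1 hw.2 w hw.1
          rw [Bform_self] at this
          exact (mul_eq_zero.1 this).resolve_left h2
        exact (hU.irreducibleOnV h2 S fun g hg =>
          hS g ((hT g hg).inf (stabilizesWedge_orthogonal (hT g hg)))).elim hS0 hS1
      obtain ⟨b, hb, hQb⟩ := hTnd.exists_nonsingular h2 (hbot ▸ hTU)
      exact ⟨b, hb, .inr (by simp [hbot]), hQb⟩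
    · obtain ⟨b, hb, hQb⟩ := hU.exists_nonsingular h2 hbot
      exact ⟨b, hUT hb, .inl hb, hQb⟩
  have hdich {a : Fin 6 → K} (ha : a ∈ wedgeForm.orthogonal U) (hQa : Qform a ≠ 0) :
      a ∈ T ∨ a ∈ wedgeForm.orthogonal T := by
    by_contra! h
    obtain ⟨haT, haT'⟩ := h
    rw [mem_orthogonal] at haT'
    push Not at haT'
    obtain ⟨x, hx, hxa⟩ := haT'
    have hx' : scaledReflection b₀ x ∈ T := scaledReflection_mem (.inl hb₀T) hx
    have h := hrefl hb₀ (.inr ha) hQb₀ hQa hx'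
    rw [scaledReflection_involutive, scaledReflection, Bform_comm, Bform_smul_left] at h
    have h' := (Submodule.sub_mem_iff_left _
      (T.smul_mem _ (T.smul_mem _ hx))).1 h
    exact haT ((Submodule.smul_mem_iff _ (mul_ne_zero (pow_ne_zero 2 hQb₀) hxa)).1 h')
  obtain ⟨a, ha, hQa, haT⟩ : ∃ a ∈ wedgeForm.orthogonal U, Qform a ≠ 0 ∧ a ∉ T := by
    by_contra! h
    refine hTtop (top_le_iff.1 ?_)
    rw [← hU.sup_orthogonal]
    exact sup_le hUT (hU.orthogonal.le_of_forall_nonsingular h2 h)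
  obtain ⟨b, hb, hQb, hbT'⟩ :
      ∃ b ∈ wedgeForm.orthogonal U, Qform b ≠ 0 ∧ b ∉ wedgeForm.orthogonal T := by
    by_contra! h
    have hle := hU.orthogonal.le_of_forall_nonsingular h2 h
    refine hTU (le_antisymm ?_ hUT)
    rw [← orthogonal_orthogonal U, ← orthogonal_orthogonal T]
    exact LinearMap.BilinForm.orthogonal_le hle
  have haT' := (hdich ha hQa).resolve_left haT
  have hbT := (hdich hb hQb).resolve_right hbT'
  have hsum {a b : Fin 6 → K} (ha : a ∈ wedgeForm.orthogonal U) (hb : b ∈ wedgeForm.orthogonal U)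
      (hQa : Qform a ≠ 0) (hQb : Qform b ≠ 0) (haT : a ∈ wedgeForm.orthogonal T) (hbT : b ∈ T) :
      Qform a + Qform b = 0 := by
    have hba : Bform b a = 0 := mem_orthogonal.1 haT b hbT
    by_contra h
    have hQ : Qform (a + b) = Qform a + Qform b := by rw [Qform_add, Bform_comm, hba, add_zero]
    rcases hdich (add_mem ha hb) (hQ ▸ h) with h1 | h1
    · have h3 := mem_orthogonal.1 haT _ h1
      rw [Bform_add_left, hba, add_zero, Bform_self] at h3
      exact mul_ne_zero h2 hQa h3
    · have h3 := mem_orthogonal.1 h1 b hbT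
      rw [Bform_comm, Bform_add_left, Bform_comm, hba, zero_add, Bform_self] at h3
      exact mul_ne_zero h2 hQb h3
  have hba : Bform b a = 0 := mem_orthogonal.1 haT' b hbT
  have hab : Bform a b = 0 := by rw [Bform_comm, hba]
  have hQab := hsum ha hb hQa hQb haT' hbT
  let X := wedgeForm.orthogonal U ⊓
    (LinearMap.ker (wedgeForm a) ⊓ LinearMap.ker (wedgeForm b))
  have hmemX {x : Fin 6 → K} :
      x ∈ X ↔ x ∈ wedgeForm.orthogonal U ∧ Bform x a = 0 ∧ Bform x b = 0 := by
    rw [Bform_comm x, Bform_comm x]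
    rfl
  have hproj {y : Fin 6 → K} (hy : y ∈ wedgeForm.orthogonal U) :
      y - (Bform y a / (2 * Qform a)) • a - (Bform y b / (2 * Qform b)) • b ∈ X := by
    refine hmemX.2 ⟨sub_mem (sub_mem hy (Submodule.smul_mem _ _ ha)) (Submodule.smul_mem _ _ hb),
      ?_, ?_⟩
    · rw [sub_eq_add_neg, sub_eq_add_neg, ← neg_smul, ← neg_smul, Bform_add_left, Bform_add_left,
        Bform_smul_left, Bform_smul_left, hba, Bform_self]
      field_simp
      ring
    · rw [sub_eq_add_neg, sub_eq_add_neg, ← neg_smul, ← neg_smul, Bform_add_left, Bform_add_left,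
        Bform_smul_left, Bform_smul_left, hab, Bform_self]
      field_simp
      ring
  have hXnd : IsNondegenerate X := by
    intro x hx hxX
    obtain ⟨hxU, hxa, hxb⟩ := hmemX.1 hx
    refine hU.orthogonal x hxU fun y hy => ?_
    have h := hxX _ (hproj hy)
    rw [sub_eq_add_neg, sub_eq_add_neg, ← neg_smul, ← neg_smul, Bform_add_left, Bform_add_left,
      Bform_smul_left, Bform_smul_left, Bform_comm a, Bform_comm b, hxa, hxb] at h
    simpa using h
  have hXbot : X = ⊥ := by
    by_contra hX
    obtain ⟨c, hc, hQc⟩ := hXnd.exists_nonsingular h2 hX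
    obtain ⟨hcU, hca, hcb⟩ := hmemX.1 hc
    rcases hdich hcU hQc with hcT | hcT
    · have h1 := hsum ha hcU hQa hQc haT' hcT
      have h3 : Qform (c + b) = 2 * Qform b := by
        rw [Qform_add, hcb]
        linear_combination h1 - hQab
      have h4 := hsum ha (add_mem hcU hb) hQa (h3 ▸ mul_ne_zero h2 hQb) haT' (add_mem hcT hbT)
      exact hQb (by linear_combination h4 - hQab - h3)
    · have h1 := hsum hcU hb hQc hQb hcT hbT
      have h3 : Qform (c + a) = 2 * Qform a := by
        rw [Qform_add, hca]
        linear_combination h1 - hQab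
      have h4 := hsum (add_mem hcU ha) hb (h3 ▸ mul_ne_zero h2 hQa) hQb (add_mem hcT haT') hbT
      exact hQa (by linear_combination h4 - hQab - h3)
  have hQe : Qform (a + b) = 0 := by rw [Qform_add, hab, hQab, add_zero]
  have hQf : Qform (a - b) = 0 := by
    rw [sub_eq_add_neg, ← neg_one_smul K b, Qform_add, Qform_smul, Bform_comm, Bform_smul_left, hba]
    linear_combination hQab
  have hef : Bform (a + b) (a - b) ≠ 0 := by
    have h : Bform (a + b) (a - b) = 2 * Qform a - 2 * Qform b := by
      simp only [Bform_eq, Qform, Pi.add_apply, Pi.sub_apply]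
      ring
    rw [h, eq_neg_of_add_eq_zero_right hQab, show 2 * Qform a - 2 * -Qform a = 2 * (2 * Qform a) by
      ring]
    exact mul_ne_zero h2 (mul_ne_zero h2 hQa)
  obtain ⟨g, hge, hgf⟩ := exists_neg_fix hQe hQf hef
  have hga : a ᵥ* wedgeMatrix (g : Matrix (Fin 4) (Fin 4) K) = -b := by
    have h := congrArg₂ (· + ·) hge hgf
    simp only [← Matrix.add_vecMul] at h
    rw [show a + b + (a - b) = (2 : K) • a by module, Matrix.smul_vecMul,
      show -(a + b) + (a - b) = (2 : K) • -b by module] at h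
    exact smul_right_injective _ h2 h
  have hgb : b ᵥ* wedgeMatrix (g : Matrix (Fin 4) (Fin 4) K) = -a := by
    rw [Matrix.add_vecMul, hga, neg_add_rev] at hge
    exact add_left_cancel hge
  have hg : StabilizesWedge g (wedgeForm.orthogonal U) := by
    refine map_eq_of_map_le (wedge_injective g) ?_
    rintro _ ⟨y, hy, rfl⟩
    have h := hproj hy
    rw [hXbot, Submodule.mem_bot, sub_sub, sub_eq_zero] at h
    rw [Matrix.vecMulLinear_apply, h, Matrix.add_vecMul, Matrix.smul_vecMul, Matrix.smul_vecMul,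
      hga, hgb]
    exact add_mem (Submodule.smul_mem _ _ (neg_mem hb)) (Submodule.smul_mem _ _ (neg_mem ha))
  have hgU := stabilizesWedge_orthogonal hg
  rw [orthogonal_orthogonal] at hgU
  have hmem : b ᵥ* wedgeMatrix (g : Matrix (Fin 4) (Fin 4) K) ∈ T := (hT g hgU).le ⟨b, hbT, rfl⟩
  rw [hgb] at hmem
  exact haT (neg_mem_iff.1 hmem)

end Quotient

theorem stmt9 (p : ℕ) (hp : p.Prime) (hodd : Odd p)
    (U : Submodule (ZMod p) (Fin 6 → ZMod p)) (hU : U ≠ ⊤) :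
    -- `GL(V)_U` acts irreducibly on `V` ...
    ((∀ S : Submodule (ZMod p) (Fin 4 → ZMod p),
        (∀ g : GL (Fin 4) (ZMod p), StabilizesWedge g U →
          Submodule.map (Matrix.vecMulLinear (g : Matrix (Fin 4) (Fin 4) (ZMod p))) S = S) →
        S = ⊥ ∨ S = ⊤) ∧
      -- ... and irreducibly on `Λ²V/U` (equivalently, every invariant
      -- subspace between `U` and `Λ²V` is `U` or `Λ²V`)
      (∀ T : Submodule (ZMod p) (Fin 6 → ZMod p), U ≤ T →
        (∀ g : GL (Fin 4) (ZMod p), StabilizesWedge g U →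
          Submodule.map (Matrix.vecMulLinear (wedgeMatrix (g : Matrix (Fin 4) (Fin 4) (ZMod p)))) T = T) →
        T = U ∨ T = ⊤))
    ↔
    -- ... if and only if `U` is non-degenerate, i.e. `U ∩ U^⊥ = 0`
    (∀ v ∈ U, (∀ u ∈ U, Bform u v = 0) → v = 0) := by
  have := Fact.mk hp
  have h2 : (2 : ZMod p) ≠ 0 := by
    refine Ring.two_ne_zero ?_
    rw [ZMod.ringChar_zmod_n]
    rintro rfl
    exact absurd hodd (by decide)
  exact ⟨fun h => isNondegenerate_of_irreducible h2 hU h.1 h.2,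
    fun h => ⟨IsNondegenerate.irreducibleOnV h2 h, IsNondegenerate.irreducibleOnQuotient h2 h⟩⟩
end

section
/- Let p be a prime and let j be an integer with 2 ≤ j ≤ p − 1. Let C be the p × p integer matrix of the cyclic permutation sending the i-th standard basis vector to the (i+1)-st (indices modulo p). Then det(I − C − C^j) ≡ (−1)^p (mod p); in particular det(I − C − C^j) ≠ 0, and consequently the abelian group Y_{p,j} = ⟨e₀, …, e_{p−1} | e_k = e_{k+1} + e_{k+j} for all k, indices mod p⟩ (the quotient of ℤ^p by the row space of I − C − C^j) is finite of order |det(I − C − C^j)|. Moreover det(I − C − C^j) = ∏_{k=0}^{p−1} (1 − ξ^k − ξ^{jk}) where ξ = e^{2πi/p}. -/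
/-- The `p × p` integer matrix of the cyclic permutation sending the `i`-th
standard basis vector to the `(i+1)`-st, indices modulo `p`. -/
def cycMat (p : ℕ) : Matrix (Fin p) (Fin p) ℤ :=
  Matrix.of fun i j => if (i.val + 1) % p = j.val then 1 else 0

/-- The complex primitive `p`-th root of unity `ξ = e^{2πi/p}`. -/
noncomputable def xi (p : ℕ) : ℂ :=
  Complex.exp (2 * Real.pi * Complex.I / p)

theorem cycMat_mul_apply {R : Type*} [CommRing R] {p : ℕ} [NeZero p]
    (A : Matrix (Fin p) (Fin p) R) (i k : Fin p) :
    ((cycMat p).map (Int.castRingHom R) * A) i k =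
      A ⟨(i.val + 1) % p, Nat.mod_lt _ (NeZero.pos p)⟩ k := by
  rw [Matrix.mul_apply, Finset.sum_eq_single ⟨(i.val + 1) % p, Nat.mod_lt _ (NeZero.pos p)⟩]
  · simp [cycMat]
  · intro l _ hl
    have : (i.val + 1) % p ≠ l.val := fun h => hl (Fin.ext h.symm)
    simp [cycMat, this]
  · simp

theorem cycMat_map_pow_apply {R : Type*} [CommRing R] {p : ℕ} [NeZero p] (n : ℕ)
    (i k : Fin p) :
    ((cycMat p).map (Int.castRingHom R) ^ n) i k = if (i.val + n) % p = k.val then 1 else 0 := by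
  induction n generalizing i with
  | zero => simp [Matrix.one_apply, Nat.mod_eq_of_lt i.isLt, Fin.ext_iff]
  | succ n ih =>
    rw [pow_succ', cycMat_mul_apply, ih]
    simp [Nat.add_assoc, Nat.add_comm 1 n]

theorem cycMat_map_pow_self {R : Type*} [CommRing R] {p : ℕ} [NeZero p] :
    (cycMat p).map (Int.castRingHom R) ^ p = 1 := by
  ext i k
  rw [cycMat_map_pow_apply]
  simp [Matrix.one_apply, Nat.mod_eq_of_lt i.isLt, Fin.ext_iff]

theorem cast_det_one_sub_cycMat {R : Type*} [CommRing R] (p j : ℕ) :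
    ((1 - cycMat p - cycMat p ^ j).det : R) =
      (1 - (cycMat p).map (Int.castRingHom R) - (cycMat p).map (Int.castRingHom R) ^ j).det := by
  rw [← eq_intCast (Int.castRingHom R), RingHom.map_det]
  simp only [map_sub, map_one, map_pow, RingHom.mapMatrix_apply]

theorem det_one_sub_cycMat_modEq {p : ℕ} (hp : p.Prime) (j : ℕ) :
    (1 - cycMat p - cycMat p ^ j).det ≡ (-1) ^ p [ZMOD p] := by
  have : Fact p.Prime := ⟨hp⟩
  have : NeZero p := ⟨hp.ne_zero⟩
  rw [← ZMod.intCast_eq_intCast_iff, cast_det_one_sub_cycMat]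
  set D := (cycMat p).map (Int.castRingHom (ZMod p)) with hD
  have hDp : D ^ p = 1 := cycMat_map_pow_self
  have h : (1 - D - D ^ j) ^ p = -1 := by
    rw [sub_pow_char_of_commute (p := p), sub_pow_char_of_commute (p := p), pow_right_comm, hDp]
    · simp
    · exact Commute.one_left _
    · exact (Commute.one_left _).sub_left ((Commute.refl D).pow_right j)
  rw [← ZMod.pow_card (1 - D - D ^ j).det, ← Matrix.det_pow, h, Matrix.det_neg]
  simp

theorem cast_det_one_sub_cycMat_eq_prod {K : Type*} [Field K] {p : ℕ} [NeZero p] {ζ : K}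
    (hζ : IsPrimitiveRoot ζ p) (j : ℕ) :
    ((1 - cycMat p - cycMat p ^ j).det : K) =
      ∏ k : Fin p, (1 - ζ ^ (k : ℕ) - ζ ^ (j * (k : ℕ))) := by
  rw [cast_det_one_sub_cycMat]
  set D := (cycMat p).map (Int.castRingHom K) with hD
  set V : Matrix (Fin p) (Fin p) K := (Matrix.vandermonde fun k : Fin p => ζ ^ (k : ℕ)).transpose
    with hV
  have hdet : V.det ≠ 0 := by
    rw [hV, Matrix.det_transpose, Matrix.det_vandermonde_ne_zero_iff]
    exact fun a b h => Fin.ext (hζ.pow_inj a.isLt b.isLt h)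
  set E : Matrix (Fin p) (Fin p) K := Matrix.diagonal fun k : Fin p => ζ ^ (k : ℕ) with hE
  have hDV : SemiconjBy V E D := by
    ext i k
    rw [hD, cycMat_mul_apply, hE, Matrix.mul_diagonal]
    simp only [hV, Matrix.transpose_apply, Matrix.vandermonde_apply]
    rw [← pow_succ]
    exact pow_eq_pow_mod _ (by rw [pow_right_comm, hζ.pow_eq_one, one_pow])
  have hM : SemiconjBy V (1 - E - E ^ j) (1 - D - D ^ j) :=
    ((SemiconjBy.one_right V).sub_right hDV).sub_right (hDV.pow_right j)
  have hdetM : (1 - D - D ^ j).det = (1 - E - E ^ j).det := by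
    have := congrArg Matrix.det hM.eq
    rw [Matrix.det_mul, Matrix.det_mul, mul_comm] at this
    exact (mul_right_cancel₀ hdet this).symm
  rw [hdetM, hE, Matrix.diagonal_pow, ← Matrix.diagonal_one, Matrix.diagonal_sub,
    Matrix.diagonal_sub, Matrix.det_diagonal]
  simp [← pow_mul, mul_comm]

theorem Matrix.card_quotient_range_vecMulLinear {n : Type*} [Fintype n] [DecidableEq n]
    (A : Matrix n n ℤ) (hA : A.det ≠ 0) :
    Nat.card ((n → ℤ) ⧸ LinearMap.range A.vecMulLinear) = A.det.natAbs := by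
  have hinj : Function.Injective A.vecMulLinear := by
    rw [← LinearMap.ker_eq_bot, LinearMap.ker_eq_bot']
    exact fun v hv => Matrix.eq_zero_of_vecMul_eq_zero hA hv
  have h := Submodule.natAbs_det_equiv (LinearMap.range A.vecMulLinear)
    (LinearEquiv.ofInjective _ hinj)
  rw [← h, ← Matrix.det_transpose, ← LinearMap.det_toLin']
  congr 2
  ext v
  simp

theorem stmt14 (p : ℕ) (hp : p.Prime) (j : ℕ) (hj2 : 2 ≤ j) (hjp : j ≤ p - 1) :
    ((1 - cycMat p - cycMat p ^ j).det ≡ (-1) ^ p [ZMOD p]) ∧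
    (1 - cycMat p - cycMat p ^ j).det ≠ 0 ∧
    -- the group `Y_{p,j} = ℤ^p / (row space of I − C − C^j)` is finite …
    Finite ((Fin p → ℤ) ⧸
      LinearMap.range (Matrix.vecMulLinear (1 - cycMat p - cycMat p ^ j))) ∧
    -- … of order `|det(I − C − C^j)|`
    Nat.card ((Fin p → ℤ) ⧸
      LinearMap.range (Matrix.vecMulLinear (1 - cycMat p - cycMat p ^ j))) =
      (1 - cycMat p - cycMat p ^ j).det.natAbs ∧
    -- the product formula for the determinant
    ((1 - cycMat p - cycMat p ^ j).det : ℂ) =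
      ∏ k : Fin p, (1 - xi p ^ (k : ℕ) - xi p ^ (j * (k : ℕ))) := by
  have : NeZero p := ⟨hp.ne_zero⟩
  have hmod := det_one_sub_cycMat_modEq hp j
  have hne : (1 - cycMat p - cycMat p ^ j).det ≠ 0 := by
    intro h
    rw [h] at hmod
    have hdvd : (p : ℤ) ∣ (-1) ^ p := (Int.modEq_zero_iff_dvd).1 hmod.symm
    have hunit : IsUnit (p : ℤ) := isUnit_of_dvd_unit hdvd (isUnit_one.neg.pow p)
    exact hp.one_lt.ne' (by simpa [Int.isUnit_iff_natAbs_eq] using hunit)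
  have hcard := Matrix.card_quotient_range_vecMulLinear _ hne
  exact ⟨hmod, hne, Nat.finite_of_card_ne_zero (hcard ▸ Int.natAbs_ne_zero.2 hne), hcard,
    cast_det_one_sub_cycMat_eq_prod (Complex.isPrimitiveRoot_exp p hp.ne_zero) j⟩
end
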